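/- Let G be a finite simple graph that is 2k-connected, and suppose G has a subgraph G′ that is k-linked. Then G is k-linked. -/

import Mathlib

/-- The hypercube graph `Q_d`: vertices are functions `Fin d → Bool`, two vertices
being adjacent iff they differ in exactly one coordinate. -/
def cubeGraph (d : ℕ) : SimpleGraph (Fin d → Bool) where
  Adj x y := hammingDist x y = 1
  symm := ⟨fun x y h => by show hammingDist y x = 1; rwa [hammingDist_comm]⟩
  loopless := ⟨fun x h => by simp [hammingDist_self] at h⟩

/-- A graph `G` is `k`-linked if it has at least `2k` vertices and, for every choice of
`2k` distinct vertices `s 0, …, s (k-1), t 0, …, t (k-1)`, there exist `k` pairwise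
vertex-disjoint paths, the `i`-th joining `s i` to `t i`. -/
def IsLinked {V : Type*} (G : SimpleGraph V) (k : ℕ) : Prop :=
  2 * k ≤ Nat.card V ∧
    ∀ s t : Fin k → V, Function.Injective (Sum.elim s t) →
      ∃ P : (i : Fin k) → G.Walk (s i) (t i),
        (∀ i, (P i).IsPath) ∧
        ∀ i j, i ≠ j → ∀ v, v ∈ (P i).support → v ∉ (P j).support

/-- A graph is `m`-connected if it has more than `m` vertices and deleting any set of
fewer than `m` vertices leaves a connected graph. -/
def IsKConnected {V : Type*} (G : SimpleGraph V) (m : ℕ) : Prop :=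
  m < Nat.card V ∧ ∀ S : Set V, S.ncard < m → (G.induce Sᶜ).Connected

open Finset in
/-- In an `n`-connected graph, Hall's theorem provides a system of successors outside `A` for the
vertices outside `B`, each vertex being followed by itself or by a neighbour. -/
lemma exists_injOn_successor {V : Type*} [Fintype V] {G : SimpleGraph V} {n : ℕ}
    (hG : IsKConnected G n) (A B : Finset V) (hA : #A = n) (hB : n ≤ #B) :
    ∃ f : V → V, Set.InjOn f {v | v ∉ B} ∧ ∀ v ∉ B, f v ∉ A ∧ (f v = v ∨ G.Adj v (f v)) := by
  classical
  let t : {v // v ∉ B} → Finset V := fun v => {w | w ∉ A ∧ (w = v ∨ G.Adj v w)}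
  have hall : ∀ s : Finset {v // v ∉ B}, #s ≤ #(s.biUnion t) := by
    intro s
    by_contra! hlt
    set X : Finset V := s.map (Function.Embedding.subtype _) with hX
    set N : Finset V := {w | ∃ v ∈ X, w = v ∨ G.Adj v w} with hN
    have hXN : X ⊆ N := fun v hv => by simpa [hN] using ⟨v, hv, Or.inl rfl⟩
    have hXB : ∀ v ∈ X, v ∉ B := by
      intro v hv
      obtain ⟨u, -, rfl⟩ := Finset.mem_map.1 hv
      exact u.2
    have ht : s.biUnion t = N \ A := by
      ext w
      simp only [t, hN, hX, mem_biUnion, mem_filter, mem_univ, true_and, mem_sdiff, mem_map]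
      constructor
      · rintro ⟨v, hv, hw, h⟩
        exact ⟨⟨v, ⟨v, hv, rfl⟩, h⟩, hw⟩
      · rintro ⟨⟨-, ⟨v, hv, rfl⟩, h⟩, hw⟩
        exact ⟨v, hv, hw, h⟩
    set S : Finset V := N \ X ∪ A \ N with hS
    have hScard : #S < n := by
      have h1 := card_sdiff_add_card_eq_card hXN
      have h2 := card_sdiff_add_card_inter N A
      have h3 := card_sdiff_add_card_inter A N
      have h4 : #X = #s := card_map _
      have h5 : #S ≤ _ := card_union_le (N \ X) (A \ N)
      rw [inter_comm] at h3
      rw [ht] at hlt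
      omega
    have hconn := hG.2 (S : Set V) (by rwa [Set.ncard_coe_finset])
    obtain ⟨a, haA, haS⟩ := exists_mem_notMem_of_card_lt_card (hScard.trans_eq hA.symm)
    obtain ⟨b, hbB, hbS⟩ := exists_mem_notMem_of_card_lt_card (hScard.trans_le hB)
    have haX : a ∈ X := by
      by_contra h
      apply haS
      by_cases haN : a ∈ N <;> simp [hS, haN, h, haA]
    obtain ⟨p⟩ := hconn.preconnected ⟨a, by simpa using haS⟩ ⟨b, by simpa using hbS⟩
    obtain ⟨d, -, hd1, hd2⟩ :=
      p.exists_boundary_dart {v | (v : V) ∈ X} haX (fun h => hXB _ h hbB)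
    have hadj : G.Adj d.fst d.snd := d.adj
    have hdS : (d.snd : V) ∉ S := fun h => d.snd.2 (mem_coe.2 h)
    apply hdS
    have : (d.snd : V) ∈ N := by simpa [hN] using ⟨_, hd1, Or.inr hadj⟩
    exact mem_union_left _ (mem_sdiff.2 ⟨this, hd2⟩)
  obtain ⟨f, hf, hft⟩ := (all_card_le_biUnion_card_iff_exists_injective t).1 hall
  refine ⟨fun v => if h : v ∉ B then f ⟨v, h⟩ else v, ?_, ?_⟩
  · intro v hv w hw h
    simp only [Set.mem_ofPred_eq] at hv hw
    simp only [hv, hw, not_false_eq_true, dite_true] at h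
    simpa using hf h
  · intro v hv
    simpa [t, hv] using hft ⟨v, hv⟩

/-- Orbits of points of `A` under `f`, followed until they reach `B`, do not repeat or meet. -/
lemma iterate_eq_of_injOn {V : Type*} {f : V → V} {A B : Finset V}
    (hf : Set.InjOn f {v | v ∉ B}) (hfA : ∀ v ∉ B, f v ∉ A) {a b : V} (ha : a ∈ A) (hb : b ∈ A) :
    ∀ {i j : ℕ}, (∀ l < i, f^[l] a ∉ B) → (∀ l < j, f^[l] b ∉ B) → f^[i] a = f^[j] b →
      i = j ∧ a = b
  | 0, 0, _, _, h => ⟨rfl, h⟩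
  | 0, j + 1, _, hj, h => by
    rw [Function.iterate_succ_apply'] at h
    exact absurd (show f (f^[j] b) ∈ A from h ▸ ha) (hfA _ (hj j j.lt_succ_self))
  | i + 1, 0, hi, _, h => by
    rw [Function.iterate_succ_apply'] at h
    exact absurd (show f (f^[i] a) ∈ A from h.symm ▸ hb) (hfA _ (hi i i.lt_succ_self))
  | i + 1, j + 1, hi, hj, h => by
    rw [Function.iterate_succ_apply', Function.iterate_succ_apply'] at h
    obtain ⟨h1, h2⟩ := iterate_eq_of_injOn hf hfA ha hb (fun l hl => hi l (by omega))
      (fun l hl => hj l (by omega)) (hf (hi i i.lt_succ_self) (hj j j.lt_succ_self) h)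
    exact ⟨by omega, h2⟩

lemma exists_walk_iterate {V : Type*} {G : SimpleGraph V} {f : V → V} (a : V) (n : ℕ)
    (h : ∀ l < n, f (f^[l] a) = f^[l] a ∨ G.Adj (f^[l] a) (f (f^[l] a))) :
    ∃ p : G.Walk a (f^[n] a), ∀ v ∈ p.support, ∃ i ≤ n, v = f^[i] a := by
  induction n with
  | zero => exact ⟨.nil, fun v hv => ⟨0, le_rfl, by simpa using hv⟩⟩
  | succ n ih =>
    obtain ⟨p, hp⟩ := ih fun l hl => h l (by omega)
    rw [Function.iterate_succ_apply']
    rcases h n n.lt_succ_self with heq | hadj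
    · rw [heq]
      exact ⟨p, fun v hv => (hp v hv).imp fun i hi => ⟨by omega, hi.2⟩⟩
    · refine ⟨p.concat hadj, fun v hv => ?_⟩
      rw [SimpleGraph.Walk.support_concat, List.mem_append, List.mem_singleton] at hv
      rcases hv with hv | rfl
      · exact (hp v hv).imp fun i hi => ⟨by omega, hi.2⟩
      · exact ⟨n + 1, le_rfl, (Function.iterate_succ_apply' f n a).symm⟩

open Finset in
/-- A form of Menger's theorem: in an `n`-connected graph, a set of `n` vertices is joined by
disjoint walks to any set of at least `n` vertices. -/
lemma exists_disjoint_walks {V : Type*} [Fintype V] {G : SimpleGraph V} {n : ℕ}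
    (hG : IsKConnected G n) (A B : Finset V) (hA : #A = n) (hB : n ≤ #B) :
    ∃ (e : A → V) (p : (a : A) → G.Walk a (e a)), (∀ a, e a ∈ B) ∧
      (∀ a, ∀ v ∈ (p a).support, v ∈ B → v = e a) ∧
      ∀ a b, ∀ v ∈ (p a).support, v ∈ (p b).support → a = b := by
  classical
  obtain ⟨f, hf, hfs⟩ := exists_injOn_successor hG A B hA hB
  have hfA : ∀ v ∉ B, f v ∉ A := fun v hv => (hfs v hv).1
  have hex : ∀ a : A, ∃ n, f^[n] a ∈ B := by
    intro a
    by_contra! h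
    refine not_injective_infinite_finite (fun i : ℕ => f^[i] (a : V)) fun i j hij => ?_
    exact (iterate_eq_of_injOn hf hfA a.2 a.2 (fun l _ => h l) (fun l _ => h l) hij).1
  have hmin : ∀ a : A, ∀ l < Nat.find (hex a), f^[l] a ∉ B := fun a l hl => Nat.find_min _ hl
  choose p hp using fun a : A => exists_walk_iterate (G := G) (a : V) (Nat.find (hex a))
    fun l hl => (hfs _ (hmin a l hl)).2
  refine ⟨_, p, fun a => Nat.find_spec (hex a), fun a v hv hvB => ?_, fun a b v hva hvb => ?_⟩
  · obtain ⟨i, hi, rfl⟩ := hp a v hv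
    rw [hi.antisymm (Nat.find_min' _ hvB)]
  · obtain ⟨i, hi, rfl⟩ := hp a v hva
    obtain ⟨j, hj, hij⟩ := hp b _ hvb
    exact Subtype.ext (iterate_eq_of_injOn hf hfA a.2 b.2 (fun l hl => hmin a l (by omega))
      (fun l hl => hmin b l (by omega)) hij).2

theorem linked_of_connected_subgraph (V : Type*) [Fintype V] (G : SimpleGraph V)
    (k : ℕ) (hG : IsKConnected G (2 * k)) (G' : G.Subgraph) (hG' : IsLinked G'.coe k) :
    IsLinked G k := by
  classical
  refine ⟨hG.1.le, fun s t hst => ?_⟩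
  let A : Finset V := Finset.univ.map ⟨Sum.elim s t, hst⟩
  let B : Finset V := G'.verts.toFinset
  have hB : 2 * k ≤ B.card := by
    have := hG'.1
    rwa [Nat.card_eq_fintype_card, ← Set.toFinset_card] at this
  have hBmem : ∀ {v}, v ∈ B ↔ v ∈ G'.verts := Set.mem_toFinset
  obtain ⟨e, p, heB, hpB, hdisj⟩ := exists_disjoint_walks hG A B (by simp [A]; omega) hB
  let x : Fin k ⊕ Fin k → A := fun c =>
    ⟨Sum.elim s t c, Finset.mem_map.2 ⟨c, Finset.mem_univ c, rfl⟩⟩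
  have hx : Function.Injective x := fun c d h => hst (congrArg Subtype.val h)
  have he : Function.Injective e := fun a b h =>
    hdisj a b _ (p a).end_mem_support (by rw [h]; exact (p b).end_mem_support)
  let y : Fin k ⊕ Fin k → G'.verts := fun c => ⟨e (x c), hBmem.1 (heB _)⟩
  have hy : Function.Injective y := fun c d h => hx (he (congrArg Subtype.val h))
  obtain ⟨Q, -, hQ⟩ := hG'.2 (y ∘ Sum.inl) (y ∘ Sum.inr) (by rwa [Sum.elim_comp_inl_inr])
  let q : (i : Fin k) → G.Walk (e (x (.inl i))) (e (x (.inr i))) := fun i => (Q i).map G'.hom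
  have hq : ∀ i v, v ∈ (q i).support → ∃ h : v ∈ G'.verts, ⟨v, h⟩ ∈ (Q i).support := by
    intro i v hv
    change v ∈ ((Q i).map G'.hom).support at hv
    rw [SimpleGraph.Walk.support_map, List.mem_map] at hv
    obtain ⟨u, hu, rfl⟩ := hv
    exact ⟨u.2, hu⟩
  have hqp : ∀ i c v, v ∈ (q i).support → v ∈ (p (x c)).support → c = .inl i ∨ c = .inr i := by
    intro i c v hv hvp
    obtain ⟨hvB, hvQ⟩ := hq i v hv
    have hvy : (⟨v, hvB⟩ : G'.verts) = y c := Subtype.ext (hpB _ v hvp (hBmem.2 hvB))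
    rw [hvy] at hvQ
    rcases c with j | j
    · by_contra h
      exact hQ i j (fun hij => h (by simp [hij])) _ hvQ (Q j).start_mem_support
    · by_contra h
      exact hQ i j (fun hij => h (by simp [hij])) _ hvQ (Q j).end_mem_support
  let w : (i : Fin k) → G.Walk (s i) (t i) := fun i =>
    ((p (x (.inl i))).append (q i)).append (p (x (.inr i))).reverse
  have hw : ∀ i v, v ∈ (w i).support → v ∈ (q i).support ∨
      ∃ c, (c = .inl i ∨ c = .inr i) ∧ v ∈ (p (x c)).support := by
    intro i v hv
    rcases (SimpleGraph.Walk.mem_support_append_iff _ _).1 hv with hv | hv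
    · rcases (SimpleGraph.Walk.mem_support_append_iff _ _).1 hv with hv | hv
      · exact .inr ⟨_, .inl rfl, hv⟩
      · exact .inl hv
    · change v ∈ (p (x (.inr i))).reverse.support at hv
      rw [SimpleGraph.Walk.support_reverse, List.mem_reverse] at hv
      exact .inr ⟨_, .inr rfl, hv⟩
  refine ⟨fun i => (w i).bypass, fun i => (w i).bypass_isPath, fun i j hij v hvi hvj => hij ?_⟩
  rcases hw i v ((w i).support_bypass_subset_support hvi) with hi | ⟨c, hc, hi⟩ <;>
    rcases hw j v ((w j).support_bypass_subset_support hvj) with hj | ⟨d, hd, hj⟩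
  · by_contra h
    obtain ⟨_, hi⟩ := hq i v hi
    obtain ⟨_, hj⟩ := hq j v hj
    exact hQ i j h _ hi hj
  · have := hqp i d v hi hj
    rcases this with rfl | rfl <;> simpa using hd
  · have := hqp j c v hj hi
    rcases hc with rfl | rfl <;> simpa using this
  · obtain rfl := hx (hdisj _ _ v hi hj)
    rcases hc with rfl | rfl <;> simpa using hd
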